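/- Let Λ := ζ1 + ζ2 + ζ3 + ζ5 + ζ6 + ζ7. Then the set of Δ⁺(k)-dominant vectors of the form wΛ − ρ_c with w ∈ W has exactly 12 elements, namely (in the notation [a,b,c,d,e,f,g] := aω1+bω2+cω3+dω4+eω5+fω6+(g/3)ζ): [1,0,0,0,0,0,11], [0,0,0,0,0,1,−11], [2,0,0,0,0,0,1], [0,0,0,0,0,2,−1], [0,0,0,0,1,0,5], [0,0,1,0,0,0,−5], [0,0,0,0,0,0,15], [0,0,0,0,0,0,−15], [0,1,0,0,0,0,9], [0,1,0,0,0,0,−9], [1,0,0,0,0,1,3], [1,0,0,0,0,1,−3]. (These are exactly the highest weights of the twelve K̃-types in the Dirac cohomology of the Wallach module L(−4ζ) of E7(−25).) -/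

import Mathlib

open scoped BigOperators

namespace E7

noncomputable section

/-- The standard inner product on ℝ⁸. -/
def ip (x y : Fin 8 → ℝ) : ℝ := ∑ i, x i * y i

/-- The simple roots α₁,…,α₇ of E₇ (indexed by `Fin 7`). -/
def sroot : Fin 7 → Fin 8 → ℝ :=
  ![![1/2, -1/2, -1/2, -1/2, -1/2, -1/2, -1/2, 1/2],
    ![1, 1, 0, 0, 0, 0, 0, 0],
    ![-1, 1, 0, 0, 0, 0, 0, 0],
    ![0, -1, 1, 0, 0, 0, 0, 0],
    ![0, 0, -1, 1, 0, 0, 0, 0],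
    ![0, 0, 0, -1, 1, 0, 0, 0],
    ![0, 0, 0, 0, -1, 1, 0, 0]]

/-- The root lattice `Q`: integer linear combinations of the simple roots. -/
def latQ : Set (Fin 8 → ℝ) := {v | ∃ c : Fin 7 → ℤ, v = ∑ j, (c j : ℝ) • sroot j}

/-- The E₇ root system `Φ = {v ∈ Q : ⟨v,v⟩ = 2}`. -/
def Phi : Set (Fin 8 → ℝ) := {v | v ∈ latQ ∧ ip v v = 2}

/-- The vector ζ. -/
def zeta : Fin 8 → ℝ := ![0, 0, 0, 0, 0, 1, -1/2, 1/2]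

/-- The positive roots Δ⁺: roots that are nonnegative integer combinations
of the simple roots. -/
def PhiPos : Set (Fin 8 → ℝ) :=
  {v | v ∈ Phi ∧ ∃ c : Fin 7 → ℕ, v = ∑ j, (c j : ℝ) • sroot j}

/-- The compact positive roots Δ⁺(k) = {α ∈ Δ⁺ : ⟨α,ζ⟩ = 0}. -/
def PhiPosK : Set (Fin 8 → ℝ) := {v | v ∈ PhiPos ∧ ip v zeta = 0}

/-- The Weyl group `W` of E₇: the subgroup of linear automorphisms of ℝ⁸
generated by the reflections `s_α : v ↦ v − ⟨v,α⟩α` for `α ∈ Φ`. -/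
def W : Subgroup ((Fin 8 → ℝ) ≃ₗ[ℝ] (Fin 8 → ℝ)) :=
  Subgroup.closure {g | ∃ a ∈ Phi, ∀ v, g v = v - ip v a • a}

/-- The subgroup of `W` generated by the six compact simple reflections
`s_{γ₁},…,s_{γ₆}` (the Weyl group of E₆, i.e. of k). -/
def WK : Subgroup ((Fin 8 → ℝ) ≃ₗ[ℝ] (Fin 8 → ℝ)) :=
  Subgroup.closure
    {g | ∃ i : Fin 6, ∀ v, g v = v - ip v (sroot i.castSucc) • sroot i.castSucc}

end

/-! ### The inner product and the Cartan matrix -/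

theorem ip_comm (x y : Fin 8 → ℝ) : ip x y = ip y x := dotProduct_comm x y

theorem ip_add_left (x y z : Fin 8 → ℝ) : ip (x + y) z = ip x z + ip y z :=
  add_dotProduct x y z

theorem ip_sub_left (x y z : Fin 8 → ℝ) : ip (x - y) z = ip x z - ip y z :=
  sub_dotProduct x y z

theorem ip_neg_left (x y : Fin 8 → ℝ) : ip (-x) y = -ip x y := neg_dotProduct x y

theorem ip_smul_left (r : ℝ) (x y : Fin 8 → ℝ) : ip (r • x) y = r * ip x y :=
  smul_dotProduct r x y

theorem ip_sum_left {ι : Type*} (s : Finset ι) (f : ι → Fin 8 → ℝ) (y : Fin 8 → ℝ) :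
    ip (∑ i ∈ s, f i) y = ∑ i ∈ s, ip (f i) y :=
  sum_dotProduct s f y

theorem ip_sub_right (x y z : Fin 8 → ℝ) : ip x (y - z) = ip x y - ip x z :=
  dotProduct_sub x y z

theorem ip_smul_right (r : ℝ) (x y : Fin 8 → ℝ) : ip x (r • y) = r * ip x y :=
  dotProduct_smul r x y

theorem ip_sum_right {ι : Type*} (s : Finset ι) (x : Fin 8 → ℝ) (f : ι → Fin 8 → ℝ) :
    ip x (∑ i ∈ s, f i) = ∑ i ∈ s, ip x (f i) :=
  dotProduct_sum x s f

theorem eq_zero_of_ip_self {x : Fin 8 → ℝ} (h : ip x x = 0) : x = 0 :=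
  dotProduct_self_eq_zero.1 h

theorem ip_sroot_sroot (i j : Fin 7) : ip (sroot i) (sroot j) = CartanMatrix.E₇ i j := by
  fin_cases i <;> fin_cases j <;>
    simp [ip, sroot, CartanMatrix.E₇, Fin.sum_univ_eight] <;> norm_num

theorem ip_sroot_self (i : Fin 7) : ip (sroot i) (sroot i) = 2 := by
  rw [ip_sroot_sroot, CartanMatrix.E₇_diag, Int.cast_ofNat]

theorem ip_sroot_zeta (i : Fin 7) : ip (sroot i) zeta = if i = 6 then 1 else 0 := by
  fin_cases i <;> simp [ip, sroot, zeta, Fin.sum_univ_eight]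
  norm_num

/-! ### The span of the simple roots and coordinates on it -/

/-- The real span of the simple roots. -/
abbrev rootSpan : Submodule ℝ (Fin 8 → ℝ) := Submodule.span ℝ (Set.range sroot)

theorem sroot_mem (i : Fin 7) : sroot i ∈ rootSpan := Submodule.subset_span ⟨i, rfl⟩

theorem eq_of_ip_sroot {v w : Fin 8 → ℝ} (hv : v ∈ rootSpan) (hw : w ∈ rootSpan)
    (h : ∀ j, ip v (sroot j) = ip w (sroot j)) : v = w := by
  have key : ∀ x ∈ rootSpan, ip (v - w) x = 0 := by
    intro x hx
    induction hx using Submodule.span_induction with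
    | mem x hx => obtain ⟨j, rfl⟩ := hx; rw [ip_sub_left, h, sub_self]
    | zero => exact dotProduct_zero _
    | add x y _ _ hx hy => rw [ip_comm, ip_add_left, ip_comm x, ip_comm y, hx, hy, add_zero]
    | smul r x _ hx => rw [ip_smul_right, hx, mul_zero]
  exact sub_eq_zero.1 (eq_zero_of_ip_self (key _ (sub_mem hv hw)))

theorem coord_seven {v : Fin 8 → ℝ} (hv : v ∈ rootSpan) : v 7 = -v 6 := by
  induction hv using Submodule.span_induction with
  | mem x hx => obtain ⟨j, rfl⟩ := hx; fin_cases j <;> simp [sroot]; norm_num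
  | zero => simp
  | add x y _ _ hx hy => simp only [Pi.add_apply, hx, hy]; ring
  | smul r x _ hx => simp only [Pi.smul_apply, smul_eq_mul, hx]; ring

theorem zeta_mem : zeta ∈ rootSpan := by
  have h : zeta = (1 / 2 : ℝ) • ((2 : ℝ) • sroot 0 + (3 : ℝ) • sroot 1 + (4 : ℝ) • sroot 2 +
      (6 : ℝ) • sroot 3 + (5 : ℝ) • sroot 4 + (4 : ℝ) • sroot 5 + (3 : ℝ) • sroot 6) := by
    funext k
    fin_cases k <;> simp [zeta, sroot] <;> norm_num
  rw [h]
  refine Submodule.smul_mem _ _ ?_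
  repeat' apply Submodule.add_mem
  all_goals exact Submodule.smul_mem _ _ (sroot_mem _)

theorem ip_zeta {v : Fin 8 → ℝ} (hv : v ∈ rootSpan) :
    2 * ip v zeta = 2 * ip v (sroot 0) + 3 * ip v (sroot 1) + 4 * ip v (sroot 2) +
      6 * ip v (sroot 3) + 5 * ip v (sroot 4) + 4 * ip v (sroot 5) + 3 * ip v (sroot 6) := by
  have h := coord_seven hv
  simp [ip, zeta, sroot, Fin.sum_univ_eight]
  linarith

/-- Six times the squared length, split along `ζ` and its orthogonal complement, where the
inverse Cartan matrix of `E₆` appears. -/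
theorem six_mul_ip_self {v : Fin 8 → ℝ} (hv : v ∈ rootSpan) {n : Fin 7 → ℝ}
    (hn : ∀ j, ip v (sroot j) = n j) :
    6 * ip v v =
      2 * (4 * n 0 ^ 2 + 6 * n 1 ^ 2 + 10 * n 2 ^ 2 + 18 * n 3 ^ 2 + 10 * n 4 ^ 2 + 4 * n 5 ^ 2 +
        2 * (n 0 * (3 * n 1 + 5 * n 2 + 6 * n 3 + 4 * n 4 + 2 * n 5) +
          n 1 * (6 * n 2 + 9 * n 3 + 6 * n 4 + 3 * n 5) +
          n 2 * (12 * n 3 + 8 * n 4 + 4 * n 5) +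
          n 3 * (12 * n 4 + 6 * n 5) + n 4 * (5 * n 5))) +
      (2 * n 0 + 3 * n 1 + 4 * n 2 + 6 * n 3 + 5 * n 4 + 4 * n 5 + 3 * n 6) ^ 2 := by
  simp only [← hn]
  simp [ip, sroot, Fin.sum_univ_eight, coord_seven hv]
  ring

/-! ### Integral combinations of simple roots -/

/-- The lattice vector with the given coefficients on the simple roots. -/
noncomputable def comb (c : Fin 7 → ℤ) : Fin 8 → ℝ := ∑ j, (c j : ℝ) • sroot j

theorem comb_mem (c : Fin 7 → ℤ) : comb c ∈ rootSpan :=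
  Submodule.sum_mem _ fun j _ => Submodule.smul_mem _ _ (sroot_mem j)

theorem ip_comb_right (v : Fin 8 → ℝ) (c : Fin 7 → ℤ) :
    ip v (comb c) = ∑ j, (c j : ℝ) * ip v (sroot j) := by
  simp only [comb, ip_sum_right, ip_smul_right]

theorem ip_comb_sroot (c : Fin 7 → ℤ) (k : Fin 7) :
    ip (comb c) (sroot k) = ((∑ j, c j * CartanMatrix.E₇ j k : ℤ) : ℝ) := by
  simp only [comb, ip_sum_left, ip_smul_left, ip_sroot_sroot]
  push_cast
  rfl

theorem ip_comb_comb (c : Fin 7 → ℤ) :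
    ip (comb c) (comb c) = ((∑ i, c i * ∑ j, c j * CartanMatrix.E₇ j i : ℤ) : ℝ) := by
  simp only [ip_comb_right, ip_comb_sroot]
  push_cast
  rfl

theorem comb_mem_Phi {c : Fin 7 → ℤ} (h : ∑ i, c i * ∑ j, c j * CartanMatrix.E₇ j i = 2) :
    comb c ∈ Phi :=
  ⟨⟨c, rfl⟩, by rw [ip_comb_comb, h]; norm_num⟩

theorem comb_single (i : Fin 7) : comb (Pi.single i 1) = sroot i := by
  simp [comb, Pi.single_apply, ite_smul]

theorem comb_sub_smul (c d : Fin 7 → ℤ) (m : ℤ) :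
    comb (c - m • d) = comb c - (m : ℝ) • comb d := by
  simp [comb, sub_smul, Finset.sum_sub_distrib, Finset.smul_sum, mul_smul]

theorem ip_comb_zeta (c : Fin 7 → ℤ) : ip (comb c) zeta = c 6 := by
  simp [comb, ip_sum_left, ip_smul_left, ip_sroot_zeta]

theorem comb_eq_zero {fw : Fin 7 → Fin 8 → ℝ}
    (hfw : ∀ i j, ip (fw i) (sroot j) = if i = j then 1 else 0) {c : Fin 7 → ℤ}
    (h : comb c = 0) : c = 0 := by
  funext i
  have h0 : ip (fw i) (comb c) = 0 := by rw [h]; exact dotProduct_zero _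
  simpa [ip_comb_right, hfw] using h0

theorem comb_injective {fw : Fin 7 → Fin 8 → ℝ}
    (hfw : ∀ i j, ip (fw i) (sroot j) = if i = j then 1 else 0) : Function.Injective comb := by
  intro c d h
  have := comb_sub_smul c d 1
  rw [h, Int.cast_one, one_smul, one_smul, sub_self] at this
  exact sub_eq_zero.1 (comb_eq_zero hfw this)

/-! ### Reflections and the Weyl group -/

theorem ip_reflect {a : Fin 8 → ℝ} (ha : ip a a = 2) (v : Fin 8 → ℝ) :
    ip (v - ip v a • a) a = -ip v a := by
  rw [ip_sub_left, ip_smul_left, ha]; ring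

theorem ip_reflect_self {a : Fin 8 → ℝ} (ha : ip a a = 2) (v : Fin 8 → ℝ) :
    ip (v - ip v a • a) (v - ip v a • a) = ip v v := by
  rw [ip_sub_right, ip_smul_right, ip_reflect ha, ip_sub_left, ip_smul_left, ip_comm a v]; ring

theorem reflect_reflect {a : Fin 8 → ℝ} (ha : ip a a = 2) (v : Fin 8 → ℝ) :
    (v - ip v a • a) - ip (v - ip v a • a) a • a = v := by
  rw [ip_reflect ha]; module

theorem exists_reflection_mem_W {a : Fin 8 → ℝ} (ha : a ∈ Phi) :
    ∃ g ∈ W, ∀ v, g v = v - ip v a • a := by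
  let f : Module.Dual ℝ (Fin 8 → ℝ) :=
    { toFun := fun v => ip v a
      map_add' := fun x y => ip_add_left x y a
      map_smul' := fun r x => ip_smul_left r x a }
  have hf : f a = 2 := ha.2
  have hg : ∀ v, Module.reflection hf v = v - ip v a • a := fun v => Module.reflection_apply v hf
  exact ⟨Module.reflection hf, Subgroup.subset_closure ⟨a, ha, hg⟩, hg⟩

/-- Weights of squared length `q`: vectors in the span of the roots whose pairings with the
simple roots are integers. -/
def IsWeight (q : ℝ) (v : Fin 8 → ℝ) : Prop :=
  v ∈ rootSpan ∧ (∀ j, ∃ n : ℤ, ip v (sroot j) = n) ∧ ip v v = q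

theorem IsWeight.reflect {q : ℝ} {v a : Fin 8 → ℝ} (hv : IsWeight q v) (ha : a ∈ Phi) :
    IsWeight q (v - ip v a • a) := by
  obtain ⟨hs, hn, hq⟩ := hv
  obtain ⟨⟨c, hc⟩, h2⟩ := ha
  change a = comb c at hc
  choose n hn using hn
  refine ⟨sub_mem hs (Submodule.smul_mem _ _ (hc ▸ comb_mem c)), fun j => ?_,
    (ip_reflect_self h2 v).trans hq⟩
  refine ⟨n j - (∑ i, c i * n i) * ∑ i, c i * CartanMatrix.E₇ i j, ?_⟩
  rw [ip_sub_left, ip_smul_left, hc, ip_comb_sroot, ip_comb_right]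
  simp only [hn]
  push_cast
  rfl

theorem isWeight_iff_of_mem_W {q : ℝ} {g : (Fin 8 → ℝ) ≃ₗ[ℝ] (Fin 8 → ℝ)} (hg : g ∈ W) :
    ∀ v, IsWeight q v ↔ IsWeight q (g v) := by
  induction hg using Subgroup.closure_induction with
  | mem g hg =>
    obtain ⟨a, ha, hga⟩ := hg
    intro v
    rw [hga]
    refine ⟨fun h => h.reflect ha, fun h => ?_⟩
    have := h.reflect ha
    rwa [reflect_reflect ha.2] at this
  | one => exact fun v => Iff.rfl
  | mul g h _ _ hg hh => exact fun v => (hh v).trans (hg (h v))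
  | inv g _ hg =>
    intro v
    rw [hg (g⁻¹ v), show g (g⁻¹ v) = v from g.apply_symm_apply v]

/-- Some vector in the Weyl orbit of `v` pairs with the simple roots as prescribed by `n`. -/
def OrbitHas (v : Fin 8 → ℝ) (n : Fin 7 → ℤ) : Prop :=
  ∃ g ∈ W, ∀ k, ip (g v) (sroot k) = n k

theorem OrbitHas.reflect {v : Fin 8 → ℝ} {n : Fin 7 → ℤ} (h : OrbitHas v n) (c m : Fin 7 → ℤ)
    (hc : ∑ i, c i * ∑ j, c j * CartanMatrix.E₇ j i = 2)
    (hm : ∀ k, m k = n k - (∑ j, c j * n j) * ∑ j, c j * CartanMatrix.E₇ j k) :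
    OrbitHas v m := by
  obtain ⟨g, hg, hn⟩ := h
  obtain ⟨s, hs, hsv⟩ := exists_reflection_mem_W (comb_mem_Phi hc)
  refine ⟨s * g, mul_mem hs hg, fun k => ?_⟩
  change ip (s (g v)) (sroot k) = _
  rw [hsv, ip_sub_left, ip_smul_left, ip_comb_sroot, ip_comb_right, hm]
  simp only [hn]
  push_cast
  rfl

/-! ### The half sum of the compact positive roots -/

theorem coeff_nonneg_of_root {fw : Fin 7 → Fin 8 → ℝ}
    (hfw : ∀ i j, ip (fw i) (sroot j) = if i = j then 1 else 0) {c : Fin 7 → ℤ} {i : Fin 7}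
    (hc : ip (comb c) (comb c) = 2) (hpos : ∀ j, j ≠ i → 0 ≤ c j) (hne : ∃ j, j ≠ i ∧ c j ≠ 0) :
    0 ≤ c i := by
  by_contra! hi
  set p : Fin 7 → ℤ := c - c i • Pi.single i 1 with hp
  have hpi : p i = 0 := by simp [hp]
  have hpj : ∀ j, j ≠ i → p j = c j := fun j hj => by simp [hp, hj]
  have hcp : comb p = comb c - (c i : ℝ) • sroot i := by rw [hp, comb_sub_smul, comb_single]
  have hpp : 0 < ip (comb p) (comb p) := by
    refine lt_of_le_of_ne (Finset.sum_nonneg fun k _ => mul_self_nonneg _) fun h => ?_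
    obtain ⟨j, hj, hcj⟩ := hne
    have := congrFun (comb_eq_zero hfw (eq_zero_of_ip_self h.symm)) j
    exact hcj ((hpj j hj).symm.trans this)
  have hpa : ip (comb p) (sroot i) ≤ 0 := by
    rw [ip_comb_sroot]
    refine Int.cast_nonpos.2 (Finset.sum_nonpos fun j _ => ?_)
    rcases eq_or_ne j i with rfl | hj
    · simp [hpi]
    · refine mul_nonpos_of_nonneg_of_nonpos (hpj j hj ▸ hpos j hj) ?_
      revert hj
      clear * -
      revert i j
      decide
  have hexp : ip (comb c) (comb c) =
      ip (comb p) (comb p) + 2 * c i * ip (comb p) (sroot i) + 2 * (c i : ℝ) ^ 2 := by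
    rw [hcp]
    simp only [ip_sub_left, ip_sub_right, ip_smul_left, ip_smul_right, ip_sroot_self,
      ip_comm (sroot i) (comb c)]
    ring
  have hi' : (c i : ℝ) ≤ -1 := by exact_mod_cast Int.le_sub_one_of_lt hi
  nlinarith [mul_nonneg (neg_nonneg.2 hpa) (by linarith : (0 : ℝ) ≤ -c i)]

theorem mem_PhiPosK_iff {y : Fin 8 → ℝ} :
    y ∈ PhiPosK ↔ ∃ c : Fin 7 → ℤ, y = comb c ∧ (∀ j, 0 ≤ c j) ∧ c 6 = 0 ∧ ip y y = 2 := by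
  constructor
  · rintro ⟨⟨⟨_, h2⟩, c, hc⟩, hz⟩
    have hc' : y = comb fun j => (c j : ℤ) := by simpa [comb] using hc
    refine ⟨_, hc', fun j => Int.natCast_nonneg _, ?_, h2⟩
    rw [hc', ip_comb_zeta] at hz
    exact_mod_cast hz
  · rintro ⟨c, rfl, hpos, h6, h2⟩
    refine ⟨⟨⟨⟨c, rfl⟩, h2⟩, fun j => (c j).toNat, ?_⟩, by rw [ip_comb_zeta, h6, Int.cast_zero]⟩
    refine Finset.sum_congr rfl fun j _ => ?_
    rw [← Int.cast_natCast, Int.toNat_of_nonneg (hpos j)]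

theorem sroot_mem_PhiPosK {i : Fin 7} (hi : i ≠ 6) : sroot i ∈ PhiPosK :=
  mem_PhiPosK_iff.2 ⟨Pi.single i 1, (comb_single i).symm,
    fun j => by rw [Pi.single_apply]; split_ifs <;> simp, by simp [hi.symm], ip_sroot_self i⟩

theorem reflect_mem_PhiPosK {fw : Fin 7 → Fin 8 → ℝ}
    (hfw : ∀ i j, ip (fw i) (sroot j) = if i = j then 1 else 0) {i : Fin 7} (hi : i ≠ 6)
    {y : Fin 8 → ℝ} (hy : y ∈ PhiPosK) (hne : y ≠ sroot i) :
    y - ip y (sroot i) • sroot i ∈ PhiPosK ∧ y - ip y (sroot i) • sroot i ≠ sroot i := by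
  obtain ⟨c, rfl, hpos, h6, h2⟩ := mem_PhiPosK_iff.1 hy
  obtain ⟨j, hj, hcj⟩ : ∃ j, j ≠ i ∧ c j ≠ 0 := by
    by_contra! h
    have hc : c = 0 - (-c i) • Pi.single i 1 := by
      funext k
      rcases eq_or_ne k i with rfl | hk
      · simp
      · simp [hk, h k hk]
    have hcomb : comb c = (c i : ℝ) • sroot i := by
      rw [hc, comb_sub_smul, comb_single]
      simp [comb]
    rw [hcomb, ip_smul_left, ip_smul_right, ip_sroot_self] at h2
    have h1 : c i * c i = 1 := by
      have : (c i : ℝ) * c i = 1 := by linarith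
      exact_mod_cast this
    have hci : c i = 1 := by nlinarith [hpos i]
    exact hne (by rw [hcomb, hci, Int.cast_one, one_smul])
  set m : ℤ := ∑ j, c j * CartanMatrix.E₇ j i with hm
  have hrefl : comb c - ip (comb c) (sroot i) • sroot i = comb (c - m • Pi.single i 1) := by
    rw [comb_sub_smul, comb_single, ip_comb_sroot]
  have hother : ∀ k, k ≠ i → (c - m • (Pi.single i 1 : Fin 7 → ℤ)) k = c k := fun k hk => by simp [hk]
  have hnorm := (ip_reflect_self (ip_sroot_self i) (comb c)).trans h2
  constructor
  · refine mem_PhiPosK_iff.2 ⟨_, hrefl, fun k => ?_, by rw [hother 6 hi.symm, h6], hnorm⟩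
    rcases eq_or_ne k i with rfl | hk
    · exact coeff_nonneg_of_root hfw (hrefl ▸ hnorm) (fun k hk => hother k hk ▸ hpos k)
        ⟨j, hj, hother j hj ▸ hcj⟩
    · exact hother k hk ▸ hpos k
  · intro h
    have := congrFun (comb_injective hfw ((hrefl.symm.trans h).trans (comb_single i).symm)) j
    rw [hother j hj, Pi.single_eq_of_ne hj] at this
    exact hcj this

theorem ip_sum_PhiPosK {fw : Fin 7 → Fin 8 → ℝ}
    (hfw : ∀ i j, ip (fw i) (sroot j) = if i = j then 1 else 0)
    {sK : Finset (Fin 8 → ℝ)} (hsK : (sK : Set (Fin 8 → ℝ)) = PhiPosK) {i : Fin 7} (hi : i ≠ 6) :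
    ip (∑ y ∈ sK, y) (sroot i) = 2 := by
  classical
  have hmem : ∀ y, y ∈ sK ↔ y ∈ PhiPosK := fun y => by rw [← hsK, Finset.mem_coe]
  rw [ip_sum_left, ← Finset.add_sum_erase sK _ ((hmem _).2 (sroot_mem_PhiPosK hi)),
    ip_sroot_self, add_eq_left]
  refine Finset.sum_involution (fun y _ => y - ip y (sroot i) • sroot i) ?_ ?_ ?_ ?_
  · intro y _
    rw [ip_reflect (ip_sroot_self i), add_neg_cancel]
  · intro y _ hy h
    have := ip_reflect (ip_sroot_self i) y
    rw [h] at this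
    exact hy (by linarith)
  · intro y hy
    rw [Finset.mem_erase, hmem] at hy ⊢
    exact (reflect_mem_PhiPosK hfw hi hy.2 hy.1).symm
  · exact fun y _ => reflect_reflect (ip_sroot_self i) y

theorem sum_PhiPosK_mem {sK : Finset (Fin 8 → ℝ)} (hsK : (sK : Set (Fin 8 → ℝ)) = PhiPosK) :
    ∑ y ∈ sK, y ∈ rootSpan := by
  refine Submodule.sum_mem _ fun y hy => ?_
  rw [← Finset.mem_coe, hsK] at hy
  obtain ⟨c, rfl, -⟩ := mem_PhiPosK_iff.1 hy
  exact comb_mem c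

theorem ip_sum_PhiPosK_zeta {sK : Finset (Fin 8 → ℝ)}
    (hsK : (sK : Set (Fin 8 → ℝ)) = PhiPosK) : ip (∑ y ∈ sK, y) zeta = 0 := by
  rw [ip_sum_left]
  refine Finset.sum_eq_zero fun y hy => ?_
  rw [← Finset.mem_coe, hsK] at hy
  exact hy.2

/-! ### The twelve chambers -/

/-- The pairings of the twelve vectors, shifted by `ρ_c`, with the simple roots. -/
def shiftedLabel : Fin 12 → Fin 7 → ℤ :=
  ![![2, 1, 1, 1, 1, 1, -5],
    ![1, 1, 1, 1, 1, 2, -13],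
    ![3, 1, 1, 1, 1, 1, -9],
    ![1, 1, 1, 1, 1, 3, -11],
    ![1, 1, 1, 1, 2, 1, -8],
    ![1, 1, 2, 1, 1, 1, -11],
    ![1, 1, 1, 1, 1, 1, -3],
    ![1, 1, 1, 1, 1, 1, -13],
    ![1, 2, 1, 1, 1, 1, -6],
    ![1, 2, 1, 1, 1, 1, -12],
    ![2, 1, 1, 1, 1, 2, -9],
    ![2, 1, 1, 1, 1, 2, -11]]

theorem eq_shiftedLabel {n : Fin 7 → ℤ} (hn : ∀ i : Fin 6, 1 ≤ n i.castSucc)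
    (hq : 2 * (4 * n 0 ^ 2 + 6 * n 1 ^ 2 + 10 * n 2 ^ 2 + 18 * n 3 ^ 2 + 10 * n 4 ^ 2 +
        4 * n 5 ^ 2 +
        2 * (n 0 * (3 * n 1 + 5 * n 2 + 6 * n 3 + 4 * n 4 + 2 * n 5) +
          n 1 * (6 * n 2 + 9 * n 3 + 6 * n 4 + 3 * n 5) +
          n 2 * (12 * n 3 + 8 * n 4 + 4 * n 5) +
          n 3 * (12 * n 4 + 6 * n 5) + n 4 * (5 * n 5))) +
      (2 * n 0 + 3 * n 1 + 4 * n 2 + 6 * n 3 + 5 * n 4 + 4 * n 5 + 3 * n 6) ^ 2 = 693) :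
    ∃ k, n = shiftedLabel k := by
  obtain ⟨a, ha⟩ := Int.eq_ofNat_of_zero_le (sub_nonneg.2 (hn 0))
  obtain ⟨b, hb⟩ := Int.eq_ofNat_of_zero_le (sub_nonneg.2 (hn 1))
  obtain ⟨c, hc⟩ := Int.eq_ofNat_of_zero_le (sub_nonneg.2 (hn 2))
  obtain ⟨d, hd⟩ := Int.eq_ofNat_of_zero_le (sub_nonneg.2 (hn 3))
  obtain ⟨e, he⟩ := Int.eq_ofNat_of_zero_le (sub_nonneg.2 (hn 4))
  obtain ⟨f, hf⟩ := Int.eq_ofNat_of_zero_le (sub_nonneg.2 (hn 5))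
  replace ha : n 0 = a + 1 := eq_add_of_sub_eq ha
  replace hb : n 1 = b + 1 := eq_add_of_sub_eq hb
  replace hc : n 2 = c + 1 := eq_add_of_sub_eq hc
  replace hd : n 3 = d + 1 := eq_add_of_sub_eq hd
  replace he : n 4 = e + 1 := eq_add_of_sub_eq he
  replace hf : n 5 = f + 1 := eq_add_of_sub_eq hf
  obtain ⟨z, hz⟩ : ∃ z, n 6 = z := ⟨_, rfl⟩
  have hvec : n = ![(a : ℤ) + 1, b + 1, c + 1, d + 1, e + 1, f + 1, z] := by
    funext k
    fin_cases k <;> assumption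
  rw [ha, hb, hc, hd, he, hf, hz] at hq
  rw [hvec]
  clear hvec ha hb hc hd he hf hz hn
  have hF : (0 : ℤ) ≤ 4 * a ^ 2 + 6 * b ^ 2 + 10 * c ^ 2 + 18 * d ^ 2 + 10 * e ^ 2 + 4 * f ^ 2 +
      2 * (a * (3 * b + 5 * c + 6 * d + 4 * e + 2 * f) + b * (6 * c + 9 * d + 6 * e + 3 * f) +
        c * (12 * d + 8 * e + 4 * f) + d * (12 * e + 6 * f) + e * (5 * f)) := by positivity
  have hsq := sq_nonneg (2 * ((a : ℤ) + 1) + 3 * (b + 1) + 4 * (c + 1) + 6 * (d + 1) +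
    5 * (e + 1) + 4 * (f + 1) + 3 * z)
  have hlin : 96 * (a : ℤ) + 132 * b + 180 * c + 252 * d + 180 * e + 96 * f ≤ 225 := by linarith
  have hz : (2 * ((a : ℤ) + 1) + 3 * (b + 1) + 4 * (c + 1) + 6 * (d + 1) +
    5 * (e + 1) + 4 * (f + 1) + 3 * z) ^ 2 ≤ 15 ^ 2 := by
    have : (0 : ℤ) ≤ 96 * (a : ℤ) + 132 * b + 180 * c + 252 * d + 180 * e + 96 * f := by positivity
    linarith
  obtain ⟨hz1, hz2⟩ := abs_le.1
    (sq_le_sq₀ (abs_nonneg _) (by norm_num) |>.1 ((sq_abs _).trans_le hz))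
  clear hF hsq hz
  have had : a ≤ 2 := by omega
  have hbd : b ≤ 1 := by omega
  have hcd : c ≤ 1 := by omega
  have hdd : d = 0 := by omega
  have hed : e ≤ 1 := by omega
  have hfd : f ≤ 2 := by omega
  subst hdd
  interval_cases a <;> interval_cases b <;> interval_cases c <;> interval_cases e <;>
    interval_cases f <;> first
    | (exfalso; omega)
    | (have h1 : -20 ≤ z := by omega
       have h2 : z ≤ 0 := by omega
       clear hlin hz1 hz2
       interval_cases z <;> first
        | (exfalso; revert hq; norm_num; done)
        | decide)

theorem orbitHas_shiftedLabel {v : Fin 8 → ℝ} (h0 : OrbitHas v ![1, 1, 1, 0, 1, 1, 1]) (k : Fin 12) :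
    OrbitHas v (shiftedLabel k) := by
  have h1 := h0.reflect ![0, 0, 0, 0, 0, 1, 1] ![1, 1, 1, 0, 3, -1, -1] (by decide) (by decide)
  have h2 := h1.reflect ![0, 0, 0, 0, 0, 1, 0] ![1, 1, 1, 0, 2, 1, -2] (by decide) (by decide)
  have t6 := h2.reflect ![0, 0, 0, 0, 1, 1, 1] ![1, 1, 1, 1, 1, 1, -3] (by decide) (by decide)
  have h4 := t6.reflect ![0, 0, 1, 1, 1, 1, 1] ![2, 2, 0, 1, 1, 1, -4] (by decide) (by decide)
  have t0 := h4.reflect ![0, 1, 0, 1, 1, 1, 1] ![2, 1, 1, 1, 1, 1, -5] (by decide) (by decide)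
  have t8 := t0.reflect ![1, 0, 1, 1, 1, 1, 1] ![1, 2, 1, 1, 1, 1, -6] (by decide) (by decide)
  have h7 := t8.reflect ![0, 1, 1, 2, 1, 1, 1] ![2, 2, 1, 0, 2, 1, -7] (by decide) (by decide)
  have t4 := h7.reflect ![1, 1, 1, 1, 1, 1, 1] ![1, 1, 1, 1, 2, 1, -8] (by decide) (by decide)
  have t10 := t4.reflect ![0, 1, 1, 2, 2, 1, 1] ![2, 1, 1, 1, 1, 2, -9] (by decide) (by decide)
  have t2 := t10.reflect ![0, 1, 1, 2, 2, 2, 1] ![3, 1, 1, 1, 1, 1, -9] (by decide) (by decide)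
  have h11 := t2.reflect ![1, 1, 1, 2, 2, 1, 1] ![2, 1, 2, 1, 0, 2, -10] (by decide) (by decide)
  have t11 := h11.reflect ![1, 1, 2, 2, 1, 1, 1] ![2, 1, 1, 1, 1, 2, -11] (by decide) (by decide)
  have t5 := t11.reflect ![1, 1, 1, 2, 2, 2, 1] ![1, 1, 2, 1, 1, 1, -11] (by decide) (by decide)
  have t3 := t11.reflect ![0, 1, 1, 2, 2, 2, 1] ![1, 1, 1, 1, 1, 3, -11] (by decide) (by decide)
  have h15 := t5.reflect ![1, 1, 2, 3, 2, 1, 1] ![1, 2, 2, 0, 1, 2, -12] (by decide) (by decide)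
  have t9 := h15.reflect ![1, 1, 2, 2, 2, 2, 1] ![1, 2, 1, 1, 1, 1, -12] (by decide) (by decide)
  have t1 := t9.reflect ![1, 2, 2, 3, 2, 1, 1] ![1, 1, 1, 1, 1, 2, -13] (by decide) (by decide)
  have h18 := t1.reflect ![1, 2, 2, 3, 2, 2, 1] ![1, 0, 1, 1, 2, 1, -13] (by decide) (by decide)
  have t7 := h18.reflect ![1, 1, 2, 3, 3, 2, 1] ![1, 1, 1, 1, 1, 1, -13] (by decide) (by decide)
  fin_cases k
  exacts [t0, t1, t2, t3, t4, t5, t6, t7, t8, t9, t10, t11]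

theorem weight_ip_sroot {kw : Fin 6 → Fin 8 → ℝ}
    (hspan : ∀ i, kw i ∈ Submodule.span ℝ (Set.range fun i : Fin 6 => sroot i.castSucc))
    (hpair : ∀ i j : Fin 6, ip (kw i) (sroot j.castSucc) = if i = j then 1 else 0) (i : Fin 6) :
    kw i ∈ rootSpan ∧ ∀ j, ip (kw i) (sroot j) =
      (![![1, 0, 0, 0, 0, 0, -2 / 3], ![0, 1, 0, 0, 0, 0, -1], ![0, 0, 1, 0, 0, 0, -4 / 3],
        ![0, 0, 0, 1, 0, 0, -2], ![0, 0, 0, 0, 1, 0, -5 / 3],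
        ![0, 0, 0, 0, 0, 1, -4 / 3]] : Fin 6 → Fin 7 → ℝ) i j := by
  have hmem : kw i ∈ rootSpan :=
    Submodule.span_mono (by rintro _ ⟨i, rfl⟩; exact ⟨i.castSucc, rfl⟩) (hspan i)
  have hz : ∀ x ∈ Submodule.span ℝ (Set.range fun i : Fin 6 => sroot i.castSucc),
      ip x zeta = 0 := by
    intro x hx
    induction hx using Submodule.span_induction with
    | mem x hx =>
      obtain ⟨j, rfl⟩ := hx
      exact (ip_sroot_zeta _).trans (if_neg (Fin.castSucc_ne_last j))
    | zero => exact zero_dotProduct _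
    | add x y _ _ hx hy => rw [ip_add_left, hx, hy, add_zero]
    | smul r x _ hx => rw [ip_smul_left, hx, mul_zero]
  have h := ip_zeta hmem
  have h0 : ip (kw i) (sroot 0) = _ := hpair i 0
  have h1 : ip (kw i) (sroot 1) = _ := hpair i 1
  have h2 : ip (kw i) (sroot 2) = _ := hpair i 2
  have h3 : ip (kw i) (sroot 3) = _ := hpair i 3
  have h4 : ip (kw i) (sroot 4) = _ := hpair i 4
  have h5 : ip (kw i) (sroot 5) = _ := hpair i 5
  rw [hz _ (hspan i), h0, h1, h2, h3, h4, h5] at h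
  refine ⟨hmem, fun j => ?_⟩
  induction j using Fin.lastCases with
  | last =>
    rw [show Fin.last 6 = 6 from rfl]
    generalize ip (kw i) (sroot 6) = t at h ⊢
    clear * - h
    fin_cases i <;> simp [Fin.ext_iff] at h ⊢ <;> linarith
  | cast j =>
    rw [hpair]
    fin_cases i <;> fin_cases j <;> simp

theorem halfSum_ip_sroot {fw : Fin 7 → Fin 8 → ℝ}
    (hfw : ∀ i j, ip (fw i) (sroot j) = if i = j then 1 else 0)
    {sK : Finset (Fin 8 → ℝ)} (hsK : (sK : Set (Fin 8 → ℝ)) = PhiPosK) (j : Fin 7) :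
    ip ((1 / 2 : ℝ) • ∑ y ∈ sK, y) (sroot j) = (![1, 1, 1, 1, 1, 1, -8] : Fin 7 → ℝ) j := by
  have h : ∀ i : Fin 7, i ≠ 6 → ip (∑ y ∈ sK, y) (sroot i) = 2 :=
    fun i hi => ip_sum_PhiPosK hfw hsK hi
  have h6 := ip_zeta (sum_PhiPosK_mem hsK)
  rw [ip_sum_PhiPosK_zeta hsK, h 0 (by decide), h 1 (by decide), h 2 (by decide),
    h 3 (by decide), h 4 (by decide), h 5 (by decide)] at h6
  rw [ip_smul_left]
  induction j using Fin.lastCases with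
  | last =>
    change 1 / 2 * ip (∑ y ∈ sK, y) (sroot 6) = -8
    linarith
  | cast j =>
    rw [h _ (Fin.castSucc_ne_last j)]
    fin_cases j <;> norm_num

theorem dominant_orbit_iff {v : Fin 8 → ℝ} (hv : v ∈ rootSpan)
    (hlabel : ∀ j, ip v (sroot j) = ((![1, 1, 1, 0, 1, 1, 1] : Fin 7 → ℤ) j : ℝ)) (w : Fin 8 → ℝ) :
    ((∃ g ∈ W, w = g v) ∧ ∀ i : Fin 6, 1 ≤ ip w (sroot i.castSucc)) ↔
      w ∈ rootSpan ∧ ∃ k, ∀ j, ip w (sroot j) = shiftedLabel k j := by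
  have hnorm : ip v v = 231 / 2 := by
    have := six_mul_ip_self hv hlabel
    simp at this
    linarith
  have hweight : IsWeight (231 / 2) v := ⟨hv, fun j => ⟨_, hlabel j⟩, hnorm⟩
  constructor
  · rintro ⟨⟨g, hg, rfl⟩, hdom⟩
    obtain ⟨hs, hn, hq⟩ := (isWeight_iff_of_mem_W hg v).1 hweight
    choose n hn using hn
    have h := six_mul_ip_self hs hn
    rw [hq] at h
    obtain ⟨k, hk⟩ := eq_shiftedLabel (n := n)
      (fun i => by have := hdom i; rw [hn] at this; exact_mod_cast this)
      (by
        have h' := h.symm.trans (by norm_num : (6 * (231 / 2) : ℝ) = 693)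
        exact_mod_cast h')
    exact ⟨hs, k, fun j => by rw [hn, hk]⟩
  · rintro ⟨hw, k, hk⟩
    obtain ⟨g, hg, hgk⟩ := orbitHas_shiftedLabel ⟨1, one_mem _, hlabel⟩ k
    refine ⟨⟨g, hg, eq_of_ip_sroot hw ((isWeight_iff_of_mem_W hg v).1 hweight).1
      fun j => (hk j).trans (hgk j).symm⟩, fun i => ?_⟩
    rw [hk]
    have : ∀ (k : Fin 12) (i : Fin 6), 1 ≤ shiftedLabel k i.castSucc := by decide
    exact_mod_cast this k i

/-- for Λ = ζ₁+ζ₂+ζ₃+ζ₅+ζ₆+ζ₇, the Δ⁺(k)-dominant vectors of the form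
wΛ − ρ_c (w ∈ W) are exactly the twelve listed vectors (the highest weights of the
K̃-types in the Dirac cohomology of the Wallach module L(−4ζ)). -/
theorem e7_dirac_cohomology_wallach4
    (fw : Fin 7 → Fin 8 → ℝ)
    (hfw_span : ∀ i, fw i ∈ Submodule.span ℝ (Set.range sroot))
    (hfw_pair : ∀ i j, ip (fw i) (sroot j) = if i = j then 1 else 0)
    (kw : Fin 6 → Fin 8 → ℝ)
    (hkw_span : ∀ i, kw i ∈
      Submodule.span ℝ (Set.range fun i : Fin 6 => sroot i.castSucc))
    (hkw_pair : ∀ i j : Fin 6,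
      ip (kw i) (sroot j.castSucc) = if i = j then 1 else 0)
    (sK : Finset (Fin 8 → ℝ)) (hsK : (sK : Set (Fin 8 → ℝ)) = PhiPosK) :
    {u : Fin 8 → ℝ |
        (∃ g ∈ W, u = g (fw 0 + fw 1 + fw 2 + fw 4 + fw 5 + fw 6) -
          (1/2 : ℝ) • ∑ y ∈ sK, y) ∧
        ∀ i : Fin 6, 0 ≤ ip u (sroot i.castSucc)} =
      {kw 0 + (11/3 : ℝ) • zeta,
       kw 5 - (11/3 : ℝ) • zeta,
       (2 : ℝ) • kw 0 + (1/3 : ℝ) • zeta,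
       (2 : ℝ) • kw 5 - (1/3 : ℝ) • zeta,
       kw 4 + (5/3 : ℝ) • zeta,
       kw 2 - (5/3 : ℝ) • zeta,
       (5 : ℝ) • zeta,
       -((5 : ℝ) • zeta),
       kw 1 + (3 : ℝ) • zeta,
       kw 1 - (3 : ℝ) • zeta,
       kw 0 + kw 5 + zeta,
       kw 0 + kw 5 - zeta} := by
  set ρ : Fin 8 → ℝ := (1 / 2 : ℝ) • ∑ y ∈ sK, y with hρ
  set v := fw 0 + fw 1 + fw 2 + fw 4 + fw 5 + fw 6 with hv
  have hρmem : ρ ∈ rootSpan := Submodule.smul_mem _ _ (sum_PhiPosK_mem hsK)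
  have hρlabel := halfSum_ip_sroot hfw_pair hsK
  rw [← hρ] at hρlabel
  have hvmem : v ∈ rootSpan := by
    repeat' apply Submodule.add_mem
    all_goals exact hfw_span _
  have hvlabel : ∀ j, ip v (sroot j) = ((![1, 1, 1, 0, 1, 1, 1] : Fin 7 → ℤ) j : ℝ) := by
    intro j
    simp only [hv, ip_add_left, hfw_pair]
    fin_cases j <;> simp
  have hkmem := fun i => (weight_ip_sroot hkw_span hkw_pair i).1
  have hklabel := fun i => (weight_ip_sroot hkw_span hkw_pair i).2
  have hζlabel : ∀ j, ip zeta (sroot j) = (![0, 0, 0, 0, 0, 0, 1] : Fin 7 → ℝ) j := by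
    intro j
    rw [ip_comm, ip_sroot_zeta]
    fin_cases j <;> simp [Fin.ext_iff]
  set e : Fin 12 → Fin 8 → ℝ := ![kw 0 + (11/3 : ℝ) • zeta, kw 5 - (11/3 : ℝ) • zeta,
    (2 : ℝ) • kw 0 + (1/3 : ℝ) • zeta, (2 : ℝ) • kw 5 - (1/3 : ℝ) • zeta,
    kw 4 + (5/3 : ℝ) • zeta, kw 2 - (5/3 : ℝ) • zeta, (5 : ℝ) • zeta, -((5 : ℝ) • zeta),
    kw 1 + (3 : ℝ) • zeta, kw 1 - (3 : ℝ) • zeta, kw 0 + kw 5 + zeta, kw 0 + kw 5 - zeta] with he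
  have hemem : ∀ k, e k ∈ rootSpan := by
    have hz : ∀ r : ℝ, r • zeta ∈ rootSpan := fun r => Submodule.smul_mem _ r zeta_mem
    have hk2 : ∀ i, (2 : ℝ) • kw i ∈ rootSpan := fun i => Submodule.smul_mem _ _ (hkmem i)
    intro k
    fin_cases k
    exacts [add_mem (hkmem _) (hz _), sub_mem (hkmem _) (hz _), add_mem (hk2 _) (hz _),
      sub_mem (hk2 _) (hz _), add_mem (hkmem _) (hz _), sub_mem (hkmem _) (hz _), hz _,
      neg_mem (hz _), add_mem (hkmem _) (hz _), sub_mem (hkmem _) (hz _),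
      add_mem (add_mem (hkmem _) (hkmem _)) zeta_mem,
      sub_mem (add_mem (hkmem _) (hkmem _)) zeta_mem]
  have helabel : ∀ k j, ip (e k + ρ) (sroot j) = shiftedLabel k j := by
    intro k j
    rw [ip_add_left, hρlabel]
    fin_cases k <;>
      simp only [he, Fin.reduceFinMk, Matrix.cons_val, Fin.zero_eta, Fin.mk_one, Fin.isValue,
        ip_add_left, ip_sub_left, ip_neg_left, ip_smul_left, hklabel, hζlabel] <;>
      fin_cases j <;> simp [shiftedLabel] <;> norm_num
  trans Set.range e
  · ext u
    have hdom : (∀ i : Fin 6, 0 ≤ ip u (sroot i.castSucc)) ↔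
        ∀ i : Fin 6, 1 ≤ ip (u + ρ) (sroot i.castSucc) := by
      refine forall_congr' fun i => ?_
      have : ip ρ (sroot i.castSucc) = 1 := by
        rw [hρlabel]
        fin_cases i <;> rfl
      rw [ip_add_left, this, le_add_iff_nonneg_left]
    have horb : ∀ g : (Fin 8 → ℝ) ≃ₗ[ℝ] (Fin 8 → ℝ), u = g v - ρ ↔ u + ρ = g v :=
      fun g => eq_sub_iff_add_eq
    simp only [Set.mem_ofPred_eq, horb, hdom]
    rw [dominant_orbit_iff hvmem hvlabel]
    constructor
    · rintro ⟨hu, k, hk⟩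
      exact ⟨k, (add_right_cancel (eq_of_ip_sroot hu (add_mem (hemem k) hρmem)
        fun j => (hk j).trans (helabel k j).symm)).symm⟩
    · rintro ⟨k, rfl⟩
      exact ⟨add_mem (hemem k) hρmem, k, helabel k⟩
  · simp only [he, Matrix.range_cons, Matrix.range_empty, Set.union_empty, Set.singleton_union]

end E7
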